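/- arXiv:1409.2663 — 2 statements merged into one kernel-verified Lean document; each statement's English description precedes it below -/
import Mathlib

section
/- Let ξ, ξ₁, ξ₂, … be iid random variables with values in [1/4,∞) satisfying −∞ < E log ξ < 0, E|log(4ξ − 1)| < ∞, and (IRT-1)–(IRT-3) for some κ > 0, and consider the random logistic IFS Xₙ = ξₙ^{−1}X_{n−1}(1 − X_{n−1}) with Φ(x) = ξ^{−1}x(1 − x). Suppose additionally that 4ξ ≥ a almost surely for some a ∈ (1,4). Then any stationary distribution π of (Xₙ)ₙ≥₀ on (0,1) satisfies π((0,1/a]) = 1 and lim_{x↓0} x^{−κ}π((0,x)) = E(Φ(X)^{−κ} − (X/ξ)^{−κ})/(κμ_κ) ∈ (0,∞), where X ∼ π is independent of ξ and μ_κ = Eξ^κ log ξ. In particular, π̂, defined by π̂((x,∞)) := π((0,1/x)), has exact tail index κ. -/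
open MeasureTheory ProbabilityTheory Filter Set Topology
open scoped ENNReal

noncomputable section

/-- Conditions (IRT-1)–(IRT-3) of Goldie's implicit renewal theorem. -/
def SatisfiesIRT {Θ : Type*} [MeasurableSpace Θ] (ν : Measure Θ) (M : Θ → ℝ) (κ : ℝ) :
    Prop :=
  0 < κ ∧
  (∫ p, |M p| ^ κ ∂ν) = 1 ∧
  Integrable (fun p => |M p| ^ κ * max (Real.log |M p|) 0) ν ∧
  ∀ c : ℝ, 0 < ν {p | M p ≠ 0 ∧ ∀ k : ℤ, Real.log |M p| ≠ c * k}

section Harmonic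

variable {μ : Measure ℝ} [IsProbabilityMeasure μ]

/-- A Lipschitz function composed with a reflected translation is integrable against a
probability measure as soon as it is bounded. -/
lemma integrable_comp_sub_of_bounded {φ : ℝ → ℝ} {C : ℝ} (hC : ∀ t, |φ t| ≤ C)
    (hφ : Continuous φ) (t : ℝ) : Integrable (fun z => φ (t - z)) μ :=
  Integrable.of_bound (by fun_prop) C (.of_forall fun z => hC _)

/-- A harmonic function that is close to its supremum at `t` is also close to its supremum
at `t - z₀`, for `z₀` in the support. -/
lemma exists_near_sup_shift {ψ : ℝ → ℝ} {C S : ℝ} {L : NNReal} (hC : ∀ t, |ψ t| ≤ C)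
    (hL : LipschitzWith L ψ) (hharm : ∀ t, ψ t = ∫ z, ψ (t - z) ∂μ) (hS : ∀ t, ψ t ≤ S)
    {z₀ : ℝ} (hz₀ : ∀ δ > 0, 0 < μ (Metric.ball z₀ δ)) {η : ℝ} (hη : 0 < η) :
    ∃ ε > 0, ∀ t, S - ε < ψ t → S - η < ψ (t - z₀) := by
  have hL0 : (0 : ℝ) < 2 * L + 1 := by positivity
  set δ : ℝ := η / (2 * L + 1) with hδ
  have hδ0 : 0 < δ := by positivity
  have hp : 0 < μ.real (Metric.ball z₀ δ) :=
    ENNReal.toReal_pos (hz₀ δ hδ0).ne' (measure_ne_top _ _)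
  refine ⟨μ.real (Metric.ball z₀ δ) * (η / 2), by positivity, fun t ht => ?_⟩
  by_contra! hcon
  have hint : Integrable (fun z => S - ψ (t - z)) μ :=
    (integrable_const S).sub (integrable_comp_sub_of_bounded hC hL.continuous t)
  have h1 : ∫ z, (S - ψ (t - z)) ∂μ = S - ψ t := by
    rw [integral_sub (integrable_const S) (integrable_comp_sub_of_bounded hC hL.continuous t),
      ← hharm t]
    simp
  have h2 : ∫ z, (Metric.ball z₀ δ).indicator (fun _ => η / 2) z ∂μ ≤
      ∫ z, (S - ψ (t - z)) ∂μ := by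
    refine integral_mono ((integrable_const _).indicator measurableSet_ball) hint fun z => ?_
    by_cases hz : z ∈ Metric.ball z₀ δ
    · simp only [Set.indicator_of_mem hz]
      have hd := hL.dist_le_mul (t - z) (t - z₀)
      have hzz : dist (t - z) (t - z₀) ≤ δ := by
        rw [dist_sub_left]; exact (Metric.mem_ball.1 hz).le
      have h3 : ψ (t - z) - ψ (t - z₀) ≤ L * δ :=
        (le_abs_self _).trans (hd.trans (by gcongr))
      have h4 : L * δ ≤ η / 2 := by
        rw [hδ, mul_div_assoc', div_le_div_iff₀ hL0 two_pos]
        nlinarith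
      linarith
    · simp only [Set.indicator_of_notMem hz]
      linarith [hS (t - z)]
  rw [integral_indicator_const _ measurableSet_ball, h1, smul_eq_mul] at h2
  linarith

lemma harmonic_sub_shift_nonpos {φ : ℝ → ℝ} {C : ℝ} {L : NNReal} (hC : ∀ t, |φ t| ≤ C)
    (hL : LipschitzWith L φ) (hharm : ∀ t, φ t = ∫ z, φ (t - z) ∂μ)
    {z₀ : ℝ} (hz₀ : ∀ δ > 0, 0 < μ (Metric.ball z₀ δ)) (t : ℝ) : φ t ≤ φ (t - z₀) := by
  set ψ : ℝ → ℝ := fun t => φ t - φ (t - z₀) with hψ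
  have hψC : ∀ t, |ψ t| ≤ C + C := fun t => (abs_sub _ _).trans (add_le_add (hC _) (hC _))
  have hψL : LipschitzWith (L + L) ψ := by
    refine hL.sub ?_
    simpa [Function.comp_def] using hL.comp (LipschitzWith.id.sub (LipschitzWith.const z₀))
  have hψh : ∀ t, ψ t = ∫ z, ψ (t - z) ∂μ := fun t => by
    have : ∀ z, t - z - z₀ = t - z₀ - z := fun z => by ring
    simp only [hψ, this]
    rw [integral_sub (integrable_comp_sub_of_bounded hC hL.continuous t)
      (integrable_comp_sub_of_bounded hC hL.continuous (t - z₀)), ← hharm, ← hharm]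
  have hbdd : BddAbove (range ψ) := ⟨C + C, by
    rintro _ ⟨s, rfl⟩; exact (le_abs_self _).trans (hψC s)⟩
  set S := ⨆ t, ψ t with hSdef
  have hS : ∀ t, ψ t ≤ S := fun t => le_ciSup hbdd t
  have key : ∀ k : ℕ, ∀ η > 0, ∃ ε > 0, ∀ t, S - ε < ψ t →
      k * (S - η) ≤ φ t - φ (t - k * z₀) := by
    intro k
    induction k with
    | zero => intro η _; exact ⟨1, one_pos, fun t _ => by simp⟩
    | succ k ih =>
      intro η hη
      obtain ⟨ε₁, hε₁, h₁⟩ := ih η hη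
      obtain ⟨ε₂, hε₂, h₂⟩ := exists_near_sup_shift hψC hψL hψh hS hz₀ hε₁
      refine ⟨min ε₂ η, lt_min hε₂ hη, fun t ht => ?_⟩
      have h3 := h₁ (t - z₀) (h₂ t (by linarith [min_le_left ε₂ η]))
      have h4 : S - η < φ t - φ (t - z₀) := by
        have := min_le_right ε₂ η
        change S - min ε₂ η < φ t - φ (t - z₀) at ht
        linarith
      have h5 : t - ((k + 1 : ℕ) : ℝ) * z₀ = t - z₀ - k * z₀ := by push_cast; ring
      rw [h5]
      push_cast
      linarith
  have hSle : S ≤ 0 := by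
    by_contra! hpos
    obtain ⟨k, hk⟩ := exists_nat_gt ((C + C) / (S / 2))
    obtain ⟨ε, hε, h⟩ := key k (S / 2) (by linarith)
    obtain ⟨t, ht⟩ := exists_lt_of_lt_ciSup (show S - ε < ⨆ t, ψ t by linarith)
    have h1 := h t ht
    rw [div_lt_iff₀ (by linarith)] at hk
    have h2 := (abs_le.1 (hC t)).2
    have h3 := (abs_le.1 (hC (t - k * z₀))).1
    linarith
  have := (hS t).trans hSle
  simp only [hψ] at this
  linarith

/-- Points of the support are periods of bounded Lipschitz harmonic functions. -/
lemma harmonic_shift_eq {φ : ℝ → ℝ} {C : ℝ} {L : NNReal} (hC : ∀ t, |φ t| ≤ C)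
    (hL : LipschitzWith L φ) (hharm : ∀ t, φ t = ∫ z, φ (t - z) ∂μ)
    {z₀ : ℝ} (hz₀ : ∀ δ > 0, 0 < μ (Metric.ball z₀ δ)) (t : ℝ) : φ (t - z₀) = φ t := by
  refine le_antisymm ?_ (harmonic_sub_shift_nonpos hC hL hharm hz₀ t)
  have := harmonic_sub_shift_nonpos (φ := fun t => -φ t) (by simpa using hC) hL.neg
    (fun t => by rw [integral_neg, ← hharm]) hz₀ t
  linarith

/-- **Choquet–Deny** on the line for nonarithmetic laws and bounded Lipschitz functions. -/
theorem harmonic_const {φ : ℝ → ℝ} {C : ℝ} {L : NNReal} (hC : ∀ t, |φ t| ≤ C)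
    (hL : LipschitzWith L φ) (hharm : ∀ t, φ t = ∫ z, φ (t - z) ∂μ)
    (hna : ∀ c : ℝ, 0 < μ {z | ∀ k : ℤ, z ≠ c * k}) (s t : ℝ) : φ s = φ t := by
  let P : AddSubgroup ℝ :=
    { carrier := {p | ∀ t, φ (t - p) = φ t}
      zero_mem' := fun t => by simp
      add_mem' := fun {p q} hp hq t => by rw [← sub_sub, hq, hp]
      neg_mem' := fun {p} hp t => by rw [← hp (t - -p)]; congr 1; ring }
  have hsupp : μ.support ⊆ P := fun z hz t =>
    harmonic_shift_eq hC hL hharm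
      (fun δ hδ => Measure.mem_support_iff_forall z |>.1 hz _ (Metric.ball_mem_nhds z hδ)) t
  have hdense : Dense (P : Set ℝ) := by
    rcases P.dense_or_cyclic with h | ⟨c, hc⟩
    · exact h
    · exfalso
      refine (hna c).ne' (measure_mono_null (t := μ.supportᶜ) (fun z hz hzs => ?_)
        Measure.measure_compl_support)
      have hzP : z ∈ P := hsupp hzs
      rw [hc, AddSubgroup.mem_closure_singleton] at hzP
      obtain ⟨k, hk⟩ := hzP
      exact hz k (by rw [← hk, zsmul_eq_mul, mul_comm])
  have hclosed : IsClosed {p : ℝ | φ (t - p) = φ t} :=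
    isClosed_eq (by have := hL.continuous; fun_prop) continuous_const
  have hall : (t - s) ∈ {p : ℝ | φ (t - p) = φ t} :=
    hclosed.closure_subset_iff.2 (fun p (hp : p ∈ P) => hp t) (hdense (t - s))
  simpa using hall

/-- Lipschitz solutions of the renewal equation with constant inhomogeneity are linear. -/
lemma affine_harmonic_eq {u : ℝ → ℝ} {γ m : ℝ} {L : NNReal} (hL : LipschitzWith L u)
    (hu0 : u 0 = 0) (hid : Integrable (fun z => z) μ) (hm : ∫ z, z ∂μ = m) (hmpos : 0 < m)
    (hna : ∀ c : ℝ, 0 < μ {z | ∀ k : ℤ, z ≠ c * k})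
    (hu : ∀ s, u s = (∫ z, u (s - z) ∂μ) + γ) (s : ℝ) : u s = γ / m * s := by
  have hcont := hL.continuous
  have hint : ∀ s, Integrable (fun z => u (s - z)) μ := fun s => by
    refine Integrable.mono' (g := fun z => L * (|s| + |z|))
      (((integrable_const _).add hid.abs).const_mul _) (by fun_prop) (.of_forall fun z => ?_)
    have := hL.dist_le_mul (s - z) 0
    rw [hu0, dist_zero_right, dist_zero_right] at this
    exact this.trans (by gcongr; exact norm_sub_le s z)
  have hadd : ∀ s d, u (s + d) = u s + u d := fun s d => by
    have := harmonic_const (μ := μ) (φ := fun s => u (s + d) - u s) (C := L * |d|) (L := L + L)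
      (fun t => by simpa [Real.dist_eq] using hL.dist_le_mul (t + d) t)
      ((by simpa [Function.comp_def] using hL.comp (LipschitzWith.id.add (LipschitzWith.const d)) :
        LipschitzWith L fun s => u (s + d)).sub hL)
      (fun t => by
        have e : ∀ z, t - z + d = t + d - z := fun z => by ring
        simp only [e]
        rw [integral_sub (hint _) (hint _)]
        linarith [hu t, hu (t + d)]) hna s 0
    simp only [zero_add, hu0, sub_zero] at this
    linarith
  let f : ℝ →+ ℝ := ⟨⟨u, hu0⟩, hadd⟩
  have hlin : ∀ s, u s = s * u 1 := fun s => by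
    have := map_real_smul f hcont s 1
    simpa [f] using this
  have h0 := hu 0
  simp only [hu0, zero_sub] at h0
  have hneg : ∫ z, u (-z) ∂μ = -(m * u 1) := by
    simp_rw [fun z => hlin (-z)]
    rw [integral_mul_const, integral_neg, hm]; ring
  rw [hneg] at h0
  rw [hlin s, show γ = m * u 1 by linarith]
  field_simp

/-- Functions with a common growth and Lipschitz control have a pointwise convergent
subsequence. -/
lemma exists_subseq_tendsto_of_lipschitz {U : ℕ → ℝ → ℝ} {M : ℝ → ℝ}
    (hU0 : ∀ n, U n 0 = 0)
    (hUL : ∀ n A s t, |s| ≤ A → |t| ≤ A → |U n t - U n s| ≤ M A * |t - s|) :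
    ∃ (φ : ℕ → ℕ) (u : ℝ → ℝ), StrictMono φ ∧
      ∀ s, Tendsto (fun n => U (φ n) s) atTop (𝓝 (u s)) := by
  have hbd : ∀ n s, |U n s| ≤ M |s| * |s| := fun n s => by
    simpa [hU0] using hUL n |s| 0 s (by simp) le_rfl
  obtain ⟨v, -, φ, hφ, hv⟩ := (isCompact_univ_pi
    (fun q : ℚ => isCompact_Icc (a := -(M |(q : ℝ)| * |(q : ℝ)|))
      (b := M |(q : ℝ)| * |(q : ℝ)|))).tendsto_subseq
    (x := fun n (q : ℚ) => U n q) (fun n q _ => abs_le.1 (hbd n q))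
  rw [tendsto_pi_nhds] at hv
  have hex : ∀ s, ∃ l, Tendsto (fun n => U (φ n) s) atTop (𝓝 l) := fun s => by
    refine cauchySeq_tendsto_of_complete (Metric.cauchySeq_iff'.2 fun e he => ?_)
    set K := max (M (|s| + 1)) 0 + 1 with hK
    have hK0 : 0 < K := by positivity
    obtain ⟨q, hq1, hq2⟩ := exists_rat_btwn (show s < s + min 1 (e / (3 * K)) by
      have : 0 < min 1 (e / (3 * K)) := by positivity
      linarith)
    have hm1 := min_le_left 1 (e / (3 * K))
    have hm2 := min_le_right 1 (e / (3 * K))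
    have hclose : ∀ n, |U n q - U n s| < e / 3 := fun n => by
      have h1 := hUL n (|s| + 1) s q (by linarith) (by
        rw [abs_le]; constructor <;> linarith [neg_abs_le s, le_abs_self s])
      have h2 : |(q : ℝ) - s| < e / (3 * K) := by
        rw [abs_of_pos (by linarith)]; linarith
      calc |U n q - U n s| ≤ M (|s| + 1) * |q - s| := h1
        _ ≤ K * |q - s| := by gcongr; rw [hK]; linarith [le_max_left (M (|s| + 1)) 0]
        _ < K * (e / (3 * K)) := by gcongr
        _ = e / 3 := by field_simp
    obtain ⟨N, hN⟩ := Metric.cauchySeq_iff'.1 (hv q).cauchySeq (e / 3) (by positivity)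
    refine ⟨N, fun n hn => ?_⟩
    have h1 := hN n hn
    have h2 := hclose (φ n)
    have h3 := hclose (φ N)
    simp only [Real.dist_eq, Function.comp] at h1 ⊢
    rw [abs_lt] at *
    constructor <;> linarith
  choose u hu using hex
  exact ⟨φ, u, hφ, hu⟩

/-- Asymptotic solutions of the renewal equation are asymptotically linear. -/
theorem tendsto_of_asymptotic_renewal_eq {U g : ℕ → ℝ → ℝ} {ε : ℕ → ℝ} {M B γ m : ℝ}
    (hB : ∀ᵐ z ∂μ, -B ≤ z) (hid : Integrable (fun z => z) μ) (hm : ∫ z, z ∂μ = m)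
    (hmpos : 0 < m) (hna : ∀ c : ℝ, 0 < μ {z | ∀ k : ℤ, z ≠ c * k})
    (hM : 0 ≤ M) (hε0 : ∀ n, 0 ≤ ε n) (hε1 : ∀ n, ε n ≤ 1) (hε : Tendsto ε atTop (𝓝 0))
    (hUm : ∀ n, Measurable (U n)) (hU0 : ∀ n, U n 0 = 0)
    (hUL : ∀ n s t, s ≤ t → |U n t - U n s| ≤ M * Real.exp (ε n * t) * (t - s))
    (hUeq : ∀ n s, U n s = (∫ z, U n (s - z) ∂μ) + g n s)
    (hg : ∀ s, Tendsto (fun n => g n s) atTop (𝓝 γ)) (s : ℝ) :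
    Tendsto (fun n => U n s) atTop (𝓝 (γ / m * s)) := by
  have hUL' : ∀ n A s t, s ≤ A → t ≤ A → 0 ≤ A →
      |U n t - U n s| ≤ M * Real.exp A * |t - s| := by
    intro n A s t hs ht hA
    have hexp : ∀ x ≤ A, Real.exp (ε n * x) ≤ Real.exp A := fun x hx => by
      refine Real.exp_le_exp.2 ?_
      nlinarith [hε0 n, hε1 n]
    rcases le_total s t with h | h
    · rw [abs_of_nonneg (sub_nonneg.2 h)]
      refine (hUL n s t h).trans ?_
      have := hexp t ht
      have := sub_nonneg.2 h
      gcongr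
    · rw [abs_sub_comm, abs_sub_comm t s, abs_of_nonneg (sub_nonneg.2 h)]
      refine (hUL n t s h).trans ?_
      have := hexp s hs
      have := sub_nonneg.2 h
      gcongr
  refine tendsto_of_subseq_tendsto fun ns hns => ?_
  obtain ⟨φ, u, hφ, hu⟩ := exists_subseq_tendsto_of_lipschitz (U := fun n => U (ns n))
    (M := fun A => M * Real.exp A) (fun n => hU0 _) (fun n A s t hs ht =>
      hUL' _ A s t ((le_abs_self s).trans hs) ((le_abs_self t).trans ht)
        ((abs_nonneg s).trans hs))
  have hψ : Tendsto (fun n => ns (φ n)) atTop atTop := hns.comp hφ.tendsto_atTop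
  refine ⟨φ, ?_⟩
  have hulip : ∀ s t, s ≤ t → |u t - u s| ≤ M * (t - s) := fun s t hst => by
    have h1 : Tendsto (fun n => M * Real.exp (ε (ns (φ n)) * t) * (t - s)) atTop
        (𝓝 (M * Real.exp (0 * t) * (t - s))) :=
      ((((hε.comp hψ).mul_const t).rexp).const_mul M).mul_const _
    simp only [zero_mul, Real.exp_zero, mul_one] at h1
    exact le_of_tendsto_of_tendsto' ((hu t).sub (hu s)).abs h1 fun n => hUL _ s t hst
  have hL : LipschitzWith ⟨M, hM⟩ u := LipschitzWith.of_dist_le_mul fun s t => by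
    rw [Real.dist_eq, Real.dist_eq]
    rcases le_total s t with h | h
    · rw [abs_sub_comm, abs_sub_comm s t, abs_of_nonneg (sub_nonneg.2 h)]
      exact hulip s t h
    · rw [abs_of_nonneg (sub_nonneg.2 h)]
      exact hulip t s h
  have hu0 : u 0 = 0 := tendsto_nhds_unique (hu 0) (by simp [hU0])
  have hueq : ∀ s, u s = (∫ z, u (s - z) ∂μ) + γ := fun s => by
    refine tendsto_nhds_unique (hu s) ?_
    have h1 : Tendsto (fun n => ∫ z, U (ns (φ n)) (s - z) ∂μ) atTop
        (𝓝 (∫ z, u (s - z) ∂μ)) := by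
      refine tendsto_integral_of_dominated_convergence
        (fun z => M * Real.exp (|s| + |B|) * (|s| + |z|)) (fun n => ?_)
        (((integrable_const _).add hid.abs).const_mul _) (fun n => ?_)
        (.of_forall fun z => hu _)
      · exact ((hUm _).comp (measurable_const.sub measurable_id)).aestronglyMeasurable
      · filter_upwards [hB] with z hz
        have := hUL' (ns (φ n)) (|s| + |B|) 0 (s - z) (by positivity)
          (by linarith [le_abs_self s, le_abs_self B]) (by positivity)
        rw [hU0, sub_zero, sub_zero] at this
        refine this.trans ?_
        gcongr
        exact abs_sub _ _
    have := h1.add ((hg s).comp hψ)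
    refine this.congr fun n => ?_
    exact (hUeq _ s).symm
  rw [← affine_harmonic_eq hL hu0 hid hm hmpos hna hueq s]
  exact hu s

end Harmonic

section Tail

/-- The tail of `1 / X` at `exp t`, for `X ∼ π`, rescaled by `exp (κ * t)`. -/
def scaledTail (π : Measure ℝ) (κ t : ℝ) : ℝ :=
  Real.exp (κ * t) * π.real (Ioo 0 (Real.exp (-t)))

/-- The truncated moment `E min (exp (κ t), X ^ (-κ))`, for `X ∼ π`. -/
def truncMoment (π : Measure ℝ) (κ t : ℝ) : ℝ :=
  ∫ x, min (Real.exp (κ * t)) (x ^ (-κ)) ∂π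

variable {π : Measure ℝ} {κ : ℝ}

lemma scaledTail_nonneg (t : ℝ) : 0 ≤ scaledTail π κ t := by
  unfold scaledTail; positivity

lemma rpow_neg_le_exp_iff (hκ : 0 < κ) {x : ℝ} (hx : 0 < x) (t : ℝ) :
    x ^ (-κ) ≤ Real.exp (κ * t) ↔ Real.exp (-t) ≤ x := by
  rw [Real.rpow_def_of_pos hx, Real.exp_le_exp, ← Real.le_log_iff_exp_le hx]
  constructor
  · intro h; nlinarith
  · intro h; nlinarith

variable [IsProbabilityMeasure π]

lemma integrable_truncMoment (hX : ∀ᵐ x ∂π, 0 < x) (t : ℝ) :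
    Integrable (fun x => min (Real.exp (κ * t)) (x ^ (-κ))) π := by
  refine Integrable.of_bound (by fun_prop) (Real.exp (κ * t)) ?_
  filter_upwards [hX] with x hx
  rw [Real.norm_of_nonneg (by positivity)]
  exact min_le_left _ _

lemma truncMoment_mono (hκ : 0 < κ) (hX : ∀ᵐ x ∂π, 0 < x) : Monotone (truncMoment π κ) :=
  fun s t hst => integral_mono (integrable_truncMoment hX s) (integrable_truncMoment hX t)
    fun x => min_le_min_right _ (Real.exp_le_exp.2 (by gcongr))

lemma truncMoment_sub_le (hκ : 0 < κ) (hX : ∀ᵐ x ∂π, 0 < x) {s t : ℝ} (hst : s ≤ t) :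
    truncMoment π κ t - truncMoment π κ s ≤ (Real.exp (κ * (t - s)) - 1) * scaledTail π κ s := by
  have hexp : Real.exp (κ * s) ≤ Real.exp (κ * t) := Real.exp_le_exp.2 (by gcongr)
  have h1 : truncMoment π κ t - truncMoment π κ s ≤
      ∫ x, (Ioo 0 (Real.exp (-s))).indicator
        (fun _ => Real.exp (κ * t) - Real.exp (κ * s)) x ∂π := by
    unfold truncMoment
    rw [← integral_sub (integrable_truncMoment hX t) (integrable_truncMoment hX s)]
    refine integral_mono_ae ((integrable_truncMoment hX t).sub (integrable_truncMoment hX s))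
      ((integrable_const _).indicator measurableSet_Ioo) ?_
    filter_upwards [hX] with x hx
    by_cases h : x < Real.exp (-s)
    · rw [Set.indicator_of_mem (Set.mem_Ioo.2 ⟨hx, h⟩)]
      have := not_le.1 (mt (rpow_neg_le_exp_iff hκ hx s).1 (not_le.2 h))
      simp only [min_eq_left this.le]
      gcongr
      exact min_le_left _ _
    · rw [Set.indicator_of_notMem (fun h' => h h'.2)]
      have := (rpow_neg_le_exp_iff hκ hx s).2 (not_lt.1 h)
      simp [min_eq_right this, min_eq_right (this.trans hexp)]
  rw [integral_indicator_const _ measurableSet_Ioo, smul_eq_mul] at h1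
  refine h1.trans (le_of_eq ?_)
  unfold scaledTail
  rw [show κ * t = κ * (t - s) + κ * s by ring, Real.exp_add]
  ring

lemma le_truncMoment_sub (hκ : 0 < κ) (hX : ∀ᵐ x ∂π, 0 < x) {s t : ℝ} (hst : s ≤ t) :
    (1 - Real.exp (-(κ * (t - s)))) * scaledTail π κ t ≤
      truncMoment π κ t - truncMoment π κ s := by
  have hexp : Real.exp (κ * s) ≤ Real.exp (κ * t) := Real.exp_le_exp.2 (by gcongr)
  have h1 : ∫ x, (Ioo 0 (Real.exp (-t))).indicator
        (fun _ => Real.exp (κ * t) - Real.exp (κ * s)) x ∂π ≤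
      truncMoment π κ t - truncMoment π κ s := by
    unfold truncMoment
    rw [← integral_sub (integrable_truncMoment hX t) (integrable_truncMoment hX s)]
    refine integral_mono_ae ((integrable_const _).indicator measurableSet_Ioo)
      ((integrable_truncMoment hX t).sub (integrable_truncMoment hX s)) ?_
    filter_upwards [hX] with x hx
    by_cases h : x < Real.exp (-t)
    · rw [Set.indicator_of_mem (Set.mem_Ioo.2 ⟨hx, h⟩)]
      have := not_le.1 (mt (rpow_neg_le_exp_iff hκ hx t).1 (not_le.2 h))
      simp only [min_eq_left this.le, min_eq_left (hexp.trans this.le), le_refl]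
    · rw [Set.indicator_of_notMem (fun h' => h h'.2)]
      exact sub_nonneg.2 (min_le_min_right _ hexp)
  rw [integral_indicator_const _ measurableSet_Ioo, smul_eq_mul] at h1
  refine le_trans (le_of_eq ?_) h1
  unfold scaledTail
  rw [show κ * s = -(κ * (t - s)) + κ * t by ring, Real.exp_add]
  ring

/-- Exponential growth control of the tail yields local Lipschitz control of the truncated
moment. -/
lemma truncMoment_sub_le_of_scaledTail_le (hκ : 0 < κ) (hX : ∀ᵐ x ∂π, 0 < x) {K ε : ℝ}
    (hε : 0 ≤ ε) (hr : ∀ v, scaledTail π κ v ≤ K * Real.exp (ε * v)) {s t : ℝ} (hst : s ≤ t) :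
    truncMoment π κ t - truncMoment π κ s ≤
      κ * Real.exp κ * K * Real.exp (ε * t) * (t - s) := by
  have hK : 0 ≤ K := by
    have := (scaledTail_nonneg (π := π) (κ := κ) 0).trans (hr 0)
    simpa using this
  have hstep : ∀ s t : ℝ, s ≤ t → t - s ≤ 1 → truncMoment π κ t - truncMoment π κ s ≤
      κ * Real.exp κ * K * Real.exp (ε * t) * (t - s) := fun s t hst h1 => by
    have hd := sub_nonneg.2 hst
    have hx : Real.exp (κ * (t - s)) - 1 ≤ κ * (t - s) * Real.exp κ := by
      have h2 := Real.add_one_le_exp (-(κ * (t - s)))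
      have h3 : Real.exp (-(κ * (t - s))) * Real.exp (κ * (t - s)) = 1 := by
        rw [← Real.exp_add]; simp
      have h4 : Real.exp (κ * (t - s)) ≤ Real.exp κ := Real.exp_le_exp.2 (by nlinarith)
      have h5 : 0 ≤ κ * (t - s) := by positivity
      nlinarith [Real.exp_pos (κ * (t - s))]
    calc _ ≤ (Real.exp (κ * (t - s)) - 1) * scaledTail π κ s := truncMoment_sub_le hκ hX hst
      _ ≤ (κ * (t - s) * Real.exp κ) * (K * Real.exp (ε * t)) := by
        gcongr
        · exact scaledTail_nonneg s
        · exact (hr s).trans (by gcongr)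
      _ = _ := by ring
  have hind : ∀ n : ℕ, ∀ s t : ℝ, s ≤ t → t - s ≤ n → truncMoment π κ t - truncMoment π κ s ≤
      κ * Real.exp κ * K * Real.exp (ε * t) * (t - s) := by
    intro n
    induction n with
    | zero => intro s t h1 h2; exact hstep s t h1 (by push_cast at h2; linarith)
    | succ n ih =>
      intro s t h1 h2
      by_cases h : t - s ≤ 1
      · exact hstep s t h1 h
      push_cast at h2
      have h3 := hstep (t - 1) t (by linarith) (by linarith)
      have h4 := ih s (t - 1) (by linarith) (by linarith)
      have h5 : κ * Real.exp κ * K * Real.exp (ε * (t - 1)) * (t - 1 - s) ≤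
          κ * Real.exp κ * K * Real.exp (ε * t) * (t - 1 - s) := by
        have : 0 ≤ t - 1 - s := by linarith
        gcongr
        linarith
      nlinarith
  obtain ⟨n, hn⟩ := exists_nat_ge (t - s)
  exact hind n s t hst hn

lemma exists_scaledTail_le_exp (hX : ∀ᵐ x ∂π, 0 < x)
    (hmom : ∀ p, 0 < p → p < κ → Integrable (fun x => x ^ (-p)) π) {ε : ℝ} (hε : 0 < ε)
    (hεκ : ε < κ) : ∃ C, ∀ t, scaledTail π κ t ≤ C * Real.exp (ε * t) := by
  refine ⟨∫ x, x ^ (-(κ - ε)) ∂π, fun t => ?_⟩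
  have hp : 0 < κ - ε := by linarith
  have h1 := mul_meas_ge_le_integral_of_nonneg (μ := π) (f := fun x => x ^ (-(κ - ε)))
    (by filter_upwards [hX] with x hx; exact Real.rpow_nonneg hx.le _)
    (hmom (κ - ε) hp (by linarith)) (Real.exp ((κ - ε) * t))
  have h2 : π.real (Ioo 0 (Real.exp (-t))) ≤
      π.real {x | Real.exp ((κ - ε) * t) ≤ x ^ (-(κ - ε))} := by
    refine measureReal_mono (fun x hx => ?_)
    exact (not_le.1 (mt (rpow_neg_le_exp_iff hp hx.1 t).1 (not_le.2 hx.2))).le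
  calc scaledTail π κ t = Real.exp (ε * t) *
        (Real.exp ((κ - ε) * t) * π.real (Ioo 0 (Real.exp (-t)))) := by
        unfold scaledTail
        rw [← mul_assoc, ← Real.exp_add]; ring_nf
    _ ≤ Real.exp (ε * t) * ∫ x, x ^ (-(κ - ε)) ∂π := by
        gcongr
        refine le_trans ?_ h1
        gcongr
    _ = _ := mul_comm _ _

/-- If the rescaled tail is unbounded, it has arbitrarily large values which nearly dominate
the whole function up to a slow exponential factor. -/
lemma exists_near_maximal_scaledTail (hκ : 0 < κ) (hX : ∀ᵐ x ∂π, 0 < x)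
    (hmom : ∀ p, 0 < p → p < κ → Integrable (fun x => x ^ (-p)) π)
    (hunb : ¬ ∃ K, ∀ t, scaledTail π κ t ≤ K) (n : ℕ) :
    ∃ ε t, 0 < ε ∧ ε < 1 / ((n : ℝ) + 1) ∧ (n : ℝ) + 1 ≤ scaledTail π κ t ∧
      ∀ s, scaledTail π κ (t + s) ≤ 2 * scaledTail π κ t * Real.exp (ε * s) := by
  push Not at hunb
  obtain ⟨τ, hτ⟩ := hunb (2 * ((n : ℝ) + 1))
  have hlim : Tendsto (fun ε => scaledTail π κ τ * Real.exp (-(ε * τ))) (𝓝[>] 0)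
      (𝓝 (scaledTail π κ τ)) := by
    have : Continuous fun ε : ℝ => scaledTail π κ τ * Real.exp (-(ε * τ)) := by fun_prop
    simpa using (this.tendsto 0).mono_left nhdsWithin_le_nhds
  have hb : (0 : ℝ) < min κ (1 / ((n : ℝ) + 1)) := by positivity
  obtain ⟨ε, hε1, hε0, hε2⟩ :=
    ((hlim.eventually (lt_mem_nhds hτ)).and (Ioo_mem_nhdsGT hb)).exists
  have hεκ := hε2.trans_le (min_le_left _ _)
  obtain ⟨C, hC⟩ := exists_scaledTail_le_exp hX hmom hε0 hεκ
  set f : ℝ → ℝ := fun t => scaledTail π κ t * Real.exp (-(ε * t)) with hf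
  have hbdd : BddAbove (range f) := ⟨C, by
    rintro _ ⟨t, rfl⟩
    have : scaledTail π κ t * Real.exp (-(ε * t)) ≤
      C * Real.exp (ε * t) * Real.exp (-(ε * t)) := by gcongr; exact hC t
    rwa [mul_assoc C, ← Real.exp_add, add_neg_cancel, Real.exp_zero, mul_one] at this⟩
  have hS : ∀ t, f t ≤ ⨆ t, f t := le_ciSup hbdd
  have hSτ : 2 * ((n : ℝ) + 1) < ⨆ t, f t := hε1.trans_le (hS τ)
  have hn0 : (0 : ℝ) ≤ n := n.cast_nonneg
  obtain ⟨t, ht⟩ := exists_lt_of_lt_ciSup (show (⨆ t, f t) / 2 < ⨆ t, f t by linarith)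
  refine ⟨ε, t, hε0, hε2.trans_le (min_le_right _ _), ?_, fun s => ?_⟩
  · have hft : (n : ℝ) + 1 < f t := by linarith
    rcases le_or_gt 0 t with h0 | h0
    · refine hft.le.trans (mul_le_of_le_one_right (scaledTail_nonneg t) ?_)
      exact Real.exp_le_one_iff.2 (by have := mul_nonneg hε0.le h0; linarith)
    · exfalso
      have : f t ≤ 1 := by
        have h1 : f t = Real.exp ((κ - ε) * t) * π.real (Ioo 0 (Real.exp (-t))) := by
          simp only [hf, scaledTail]
          rw [mul_right_comm, ← Real.exp_add]; ring_nf
        rw [h1]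
        exact mul_le_one₀ (Real.exp_le_one_iff.2 (by nlinarith)) measureReal_nonneg
          measureReal_le_one
      linarith
  · have h1 := (hS (t + s)).trans (by linarith : (⨆ t, f t) ≤ 2 * f t)
    have h2 : f (t + s) * Real.exp (ε * (t + s)) ≤ 2 * f t * Real.exp (ε * (t + s)) := by
      gcongr
    simp only [hf] at h2
    rw [mul_assoc, ← Real.exp_add, neg_add_cancel, Real.exp_zero, mul_one] at h2
    refine h2.trans (le_of_eq ?_)
    rw [← mul_assoc, mul_assoc (2 * _), ← Real.exp_add]
    ring_nf

variable {μ : Measure ℝ} [IsProbabilityMeasure μ]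

lemma integrable_truncMoment_sub (hκ : 0 < κ) (hX : ∀ᵐ x ∂π, 0 < x) {B : ℝ}
    (hB : ∀ᵐ z ∂μ, -B ≤ z) (t : ℝ) : Integrable (fun z => truncMoment π κ (t - z)) μ := by
  have hmono := truncMoment_mono hκ hX
  refine Integrable.of_bound
    (hmono.measurable.comp (measurable_const.sub measurable_id)).aestronglyMeasurable
    (truncMoment π κ (t + B)) ?_
  filter_upwards [hB] with z hz
  rw [Real.norm_of_nonneg]
  · exact hmono (by linarith)
  · refine integral_nonneg_of_ae ?_
    filter_upwards [hX] with x hx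
    simp only [Pi.zero_apply]
    positivity

/-- Increments of the truncated moment are asymptotically linear along sequences with
controlled tails. -/
lemma tendsto_truncMoment_increment (hκ : 0 < κ) (hX : ∀ᵐ x ∂π, 0 < x) {B m : ℝ}
    (hB : ∀ᵐ z ∂μ, -B ≤ z) (hid : Integrable (fun z => z) μ) (hm : ∫ z, z ∂μ = m)
    (hmpos : 0 < m) (hna : ∀ c : ℝ, 0 < μ {z | ∀ k : ℤ, z ≠ c * k}) {G : ℝ → ℝ}
    (heq : ∀ t, truncMoment π κ t = (∫ z, truncMoment π κ (t - z) ∂μ) + G t)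
    {ε τ b : ℕ → ℝ} {A γ : ℝ} (hε0 : ∀ n, 0 ≤ ε n) (hε1 : ∀ n, ε n ≤ 1)
    (hε : Tendsto ε atTop (𝓝 0)) (hb : ∀ n, 0 < b n) (hA : 0 ≤ A)
    (hr : ∀ n s, scaledTail π κ (τ n + s) ≤ A * b n * Real.exp (ε n * s))
    (hG : ∀ s, Tendsto (fun n => G (τ n + s) / b n) atTop (𝓝 γ)) (s : ℝ) :
    Tendsto (fun n => (truncMoment π κ (τ n + s) - truncMoment π κ (τ n)) / b n) atTop
      (𝓝 (γ / m * s)) := by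
  have hmono := truncMoment_mono hκ hX
  refine tendsto_of_asymptotic_renewal_eq (μ := μ)
    (U := fun n s => (truncMoment π κ (τ n + s) - truncMoment π κ (τ n)) / b n)
    (g := fun n s => G (τ n + s) / b n) (M := κ * Real.exp κ * A) hB hid hm hmpos hna
    (by positivity) hε0 hε1 hε (fun n => ?_) (fun n => by simp) (fun n s t hst => ?_)
    (fun n s => ?_) hG s
  · exact ((hmono.measurable.comp (measurable_const.add measurable_id)).sub_const _).div_const _
  · have h0 : 0 ≤ truncMoment π κ (τ n + t) - truncMoment π κ (τ n + s) :=
      sub_nonneg.2 (hmono (by linarith))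
    have h1 := truncMoment_sub_le_of_scaledTail_le hκ hX (hε0 n)
      (K := A * b n * Real.exp (-(ε n * τ n)))
      (fun v => by
        have := hr n (v - τ n)
        rw [add_sub_cancel] at this
        refine this.trans (le_of_eq ?_)
        rw [mul_assoc _ (Real.exp _), ← Real.exp_add]
        ring_nf) (show τ n + s ≤ τ n + t by linarith)
    have h2 : Real.exp (-(ε n * τ n)) * Real.exp (ε n * (τ n + t)) = Real.exp (ε n * t) := by
      rw [← Real.exp_add]; ring_nf
    rw [← sub_div, sub_sub_sub_cancel_right, abs_of_nonneg (div_nonneg h0 (hb n).le),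
      div_le_iff₀ (hb n)]
    refine h1.trans (le_of_eq ?_)
    rw [← h2]
    ring
  · have hi := integrable_truncMoment_sub hκ hX hB (τ n + s)
    simp only [← add_sub_assoc]
    rw [integral_div, integral_sub hi (integrable_const _), heq (τ n + s)]
    simp only [integral_const, probReal_univ, one_smul]
    ring

lemma exists_scaledTail_le (hκ : 0 < κ) (hX : ∀ᵐ x ∂π, 0 < x)
    (hmom : ∀ p, 0 < p → p < κ → Integrable (fun x => x ^ (-p)) π) {B m : ℝ}
    (hB : ∀ᵐ z ∂μ, -B ≤ z) (hid : Integrable (fun z => z) μ) (hm : ∫ z, z ∂μ = m)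
    (hmpos : 0 < m) (hna : ∀ c : ℝ, 0 < μ {z | ∀ k : ℤ, z ≠ c * k}) {G : ℝ → ℝ} {D : ℝ}
    (heq : ∀ t, truncMoment π κ t = (∫ z, truncMoment π κ (t - z) ∂μ) + G t)
    (hGD : ∀ t, |G t| ≤ D) : ∃ K, ∀ t, scaledTail π κ t ≤ K := by
  by_contra hunb
  choose ε τ hε0 hε1 hlarge hr using exists_near_maximal_scaledTail hκ hX hmom hunb
  have hb : ∀ n, 0 < scaledTail π κ (τ n) := fun n =>
    lt_of_lt_of_le (by positivity) (hlarge n)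
  have hε : Tendsto ε atTop (𝓝 0) := squeeze_zero (fun n => (hε0 n).le) (fun n => (hε1 n).le)
    tendsto_one_div_add_atTop_nhds_zero_nat
  have hbtop : Tendsto (fun n => scaledTail π κ (τ n)) atTop atTop :=
    tendsto_atTop_mono hlarge
      (tendsto_atTop_add_const_right _ _ tendsto_natCast_atTop_atTop)
  have hD : 0 ≤ D := (abs_nonneg _).trans (hGD 0)
  have hlim := tendsto_truncMoment_increment hκ hX hB hid hm hmpos hna heq (A := 2) (γ := 0)
    (fun n => (hε0 n).le) (fun n => (hε1 n).le.trans ?_) hε hb zero_le_two hr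
    (fun s => squeeze_zero_norm (fun n => ?_) (hbtop.const_div_atTop D)) (-1)
  · rw [zero_div, zero_mul] at hlim
    have hle : (0 : ℝ) ≤ -(1 - Real.exp (-κ)) := by
      refine le_of_tendsto' hlim fun n => ?_
      rw [div_le_iff₀ (hb n)]
      have := le_truncMoment_sub hκ hX (show τ n + -1 ≤ τ n by linarith)
      rw [show κ * (τ n - (τ n + -1)) = κ by ring] at this
      linarith
    have : Real.exp (-κ) < 1 := Real.exp_lt_one_iff.2 (by linarith)
    linarith
  · rw [div_le_one (by positivity)]
    linarith [(n.cast_nonneg : (0 : ℝ) ≤ n)]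
  · rw [norm_div, Real.norm_of_nonneg (hb n).le]
    exact div_le_div_of_nonneg_right (hGD _) (hb n).le

/-- Pure exponential tails from a renewal equation for the truncated moment. -/
theorem tendsto_scaledTail (hκ : 0 < κ) (hX : ∀ᵐ x ∂π, 0 < x)
    (hmom : ∀ p, 0 < p → p < κ → Integrable (fun x => x ^ (-p)) π) {B m : ℝ}
    (hB : ∀ᵐ z ∂μ, -B ≤ z) (hid : Integrable (fun z => z) μ) (hm : ∫ z, z ∂μ = m)
    (hmpos : 0 < m) (hna : ∀ c : ℝ, 0 < μ {z | ∀ k : ℤ, z ≠ c * k}) {G : ℝ → ℝ} {D : ℝ}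
    (heq : ∀ t, truncMoment π κ t = (∫ z, truncMoment π κ (t - z) ∂μ) + G t)
    (hGD : ∀ t, |G t| ≤ D) (hG : Tendsto G atTop (𝓝 D)) :
    Tendsto (scaledTail π κ) atTop (𝓝 (D / (κ * m))) := by
  obtain ⟨K, hK⟩ := exists_scaledTail_le hκ hX hmom hB hid hm hmpos hna heq hGD
  have hK0 : 0 ≤ K := (scaledTail_nonneg 0).trans (hK 0)
  have hD : 0 ≤ D := (abs_nonneg _).trans (hGD 0)
  have hinc : ∀ s, Tendsto (fun t => truncMoment π κ (t + s) - truncMoment π κ t) atTop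
      (𝓝 (D / m * s)) := fun s => by
    refine tendsto_of_seq_tendsto fun τ hτ => ?_
    simpa [Function.comp_def] using tendsto_truncMoment_increment hκ hX hB hid hm hmpos hna heq
      (ε := fun _ => 0)
      (τ := τ) (b := fun _ => 1) (A := K) (γ := D) (fun _ => le_rfl) (fun _ => zero_le_one)
      tendsto_const_nhds (fun _ => one_pos) hK0 (by simpa using fun n s => hK (τ n + s))
      (fun s => by simpa [Function.comp_def] using hG.comp (tendsto_atTop_add_const_right _ s hτ)) s
  have hslope : Tendsto (fun s => (Real.exp (κ * s) - 1) / s) (𝓝[≠] 0) (𝓝 κ) := by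
    have : HasDerivAt (fun s => Real.exp (κ * s)) κ 0 := by
      simpa using ((hasDerivAt_id (0 : ℝ)).const_mul κ).exp
    simpa [hasDerivAt_iff_tendsto_slope, slope_fun_def, div_eq_inv_mul] using this
  have hslope' : Tendsto (fun s => (D / m) / ((Real.exp (κ * s) - 1) / s)) (𝓝[≠] 0)
      (𝓝 (D / (κ * m))) := by
    have := (tendsto_const_nhds (x := D / m)).div hslope hκ.ne'
    rwa [div_div, mul_comm m κ] at this
  have hexp1 : ∀ s, 0 < s → 1 < Real.exp (κ * s) := fun s hs =>
    Real.one_lt_exp_iff.2 (by positivity)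
  refine tendsto_order.2 ⟨fun c hc => ?_, fun c hc => ?_⟩
  · obtain ⟨s, hs, hs0⟩ := (((hslope'.mono_left (nhdsGT_le_nhdsNE 0)).eventually
      (lt_mem_nhds hc)).and self_mem_nhdsWithin).exists
    have hs0 : 0 < s := hs0
    have he := hexp1 s hs0
    have hc' : c * (Real.exp (κ * s) - 1) < D / m * s := by
      rwa [lt_div_iff₀ (div_pos (by linarith) hs0), mul_div_assoc', div_lt_iff₀ hs0] at hs
    filter_upwards [(hinc s).eventually (lt_mem_nhds hc')] with t ht
    have h1 := truncMoment_sub_le hκ hX (show t ≤ t + s by linarith)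
    rw [add_sub_cancel_left] at h1
    nlinarith
  · have hneg : Tendsto (fun s : ℝ => -s) (𝓝[>] 0) (𝓝[≠] 0) := by
      refine tendsto_nhdsWithin_iff.2 ⟨?_, ?_⟩
      · simpa using (continuous_neg.tendsto (0 : ℝ)).mono_left nhdsWithin_le_nhds
      · filter_upwards [self_mem_nhdsWithin] with s hs
        exact (neg_neg_of_pos hs).ne
    obtain ⟨s, hs, hs0⟩ := (((hslope'.comp hneg).eventually
      (gt_mem_nhds hc)).and self_mem_nhdsWithin).exists
    have hs0 : 0 < s := hs0
    have he : Real.exp (-(κ * s)) < 1 := Real.exp_lt_one_iff.2 (by nlinarith)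
    simp only [Function.comp, mul_neg] at hs
    have hc' : -(c * (1 - Real.exp (-(κ * s)))) < D / m * -s := by
      rw [div_neg, ← neg_div, neg_sub, div_lt_iff₀ (div_pos (by linarith) hs0),
        mul_div_assoc', lt_div_iff₀ hs0] at hs
      linarith
    filter_upwards [(hinc (-s)).eventually (lt_mem_nhds hc')] with t ht
    have h1 := le_truncMoment_sub hκ hX (show t + -s ≤ t by linarith)
    rw [show κ * (t - (t + -s)) = κ * s by ring] at h1
    nlinarith

end Tail

section Logistic

lemma rpow_mul_log_le {κ y : ℝ} (hy : 0 < y) :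
    y ^ κ - 1 ≤ κ * (y ^ κ * Real.log y) := by
  have h := Real.log_le_sub_one_of_pos (inv_pos.2 (Real.rpow_pos_of_pos hy κ))
  have hp := Real.rpow_pos_of_pos hy κ
  rw [Real.log_inv, Real.log_rpow hy] at h
  have := mul_le_mul_of_nonneg_left h hp.le
  rw [mul_sub, mul_inv_cancel₀ hp.ne'] at this
  linarith

lemma rpow_mul_log_lt {κ y : ℝ} (hκ : 0 < κ) (hy : 0 < y) (hlog : Real.log y ≠ 0) :
    y ^ κ - 1 < κ * (y ^ κ * Real.log y) := by
  have hp := Real.rpow_pos_of_pos hy κ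
  have hne : (y ^ κ)⁻¹ ≠ 1 := fun h => by
    have h1 := congrArg Real.log h
    rw [Real.log_inv, Real.log_rpow hy, Real.log_one] at h1
    exact (mul_ne_zero hκ.ne' hlog) (by linarith)
  have h := Real.log_lt_sub_one_of_pos (inv_pos.2 hp) hne
  rw [Real.log_inv, Real.log_rpow hy] at h
  have := mul_lt_mul_of_pos_left h hp
  rw [mul_sub, mul_inv_cancel₀ hp.ne'] at this
  linarith

lemma rpow_le_affine {p κ y : ℝ} (hp : 0 < p) (hpκ : p < κ) (hy : 0 < y) :
    y ^ p ≤ 1 + p / κ * (y ^ κ - 1) := by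
  have hκ := hp.trans hpκ
  have h := rpow_one_add_le_one_add_mul_self (s := y ^ κ - 1)
    (by linarith [Real.rpow_pos_of_pos hy κ]) (div_pos hp hκ).le ((div_le_one hκ).2 hpκ.le)
  rwa [add_sub_cancel, ← Real.rpow_mul hy.le, mul_div_cancel₀ _ hκ.ne'] at h

lemma rpow_lt_affine {p κ y : ℝ} (hp : 0 < p) (hpκ : p < κ) (hy : 0 < y)
    (hlog : Real.log y ≠ 0) : y ^ p < 1 + p / κ * (y ^ κ - 1) := by
  have hκ := hp.trans hpκ
  have hne : y ^ κ - 1 ≠ 0 := fun h => by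
    have h1 := congrArg Real.log (sub_eq_zero.1 h)
    rw [Real.log_rpow hy, Real.log_one] at h1
    exact (mul_ne_zero hκ.ne' hlog) h1
  have h := rpow_one_add_lt_one_add_mul_self (s := y ^ κ - 1)
    (by linarith [Real.rpow_pos_of_pos hy κ]) hne (div_pos hp hκ) ((div_lt_one hκ).2 hpκ)
  rwa [add_sub_cancel, ← Real.rpow_mul hy.le, mul_div_cancel₀ _ hκ.ne'] at h

/-- Near zero, negative powers of `1 - x` are at most affine. -/
lemma exists_one_sub_rpow_neg_le {a κ : ℝ} (ha : 1 < a) (hκ : 0 < κ) :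
    ∃ c > 0, ∀ x, 0 < x → x ≤ a⁻¹ → (1 - x) ^ (-κ) ≤ 1 + c * x := by
  have ha0 : 0 < a := by linarith
  have hb : 0 < 1 - a⁻¹ := sub_pos.2 (inv_lt_one_of_one_lt₀ ha)
  set b := κ * (1 - a⁻¹)⁻¹ with hbdef
  have hb0 : 0 < b := by positivity
  refine ⟨b * Real.exp b, by positivity, fun x hx hxa => ?_⟩
  have hw : 0 < 1 - x := by linarith
  have hx1 : x ≤ 1 := by linarith
  have h1 : -Real.log (1 - x) ≤ (1 - a⁻¹)⁻¹ * x := by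
    have h2 := Real.log_le_sub_one_of_pos (inv_pos.2 hw)
    rw [Real.log_inv] at h2
    calc _ ≤ (1 - x)⁻¹ - 1 := h2
      _ = (1 - x)⁻¹ * x := by field_simp; ring
      _ ≤ _ := by gcongr
  have h3 : (1 - x) ^ (-κ) ≤ Real.exp (b * x) := by
    rw [Real.rpow_def_of_pos hw]
    refine Real.exp_le_exp.2 ?_
    rw [hbdef]
    nlinarith
  have h4 := Real.add_one_le_exp (-(b * x))
  have h5 : Real.exp (-(b * x)) * Real.exp (b * x) = 1 := by rw [← Real.exp_add]; simp
  have h6 : Real.exp (b * x) ≤ Real.exp b := Real.exp_le_exp.2 (by nlinarith)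
  have h7 : 0 ≤ b * x := by positivity
  nlinarith [Real.exp_pos (b * x)]

variable {ν : Measure ℝ} [IsProbabilityMeasure ν] {κ : ℝ}

lemma integral_rpow_lt_one {p : ℝ} (hp : 0 < p) (hpκ : p < κ) (hν : ∀ᵐ y ∂ν, 0 < y)
    (hint : Integrable (fun y => y ^ κ) ν) (hone : ∫ y, y ^ κ ∂ν = 1)
    (hne : ν {y | Real.log y ≠ 0} ≠ 0) :
    Integrable (fun y => y ^ p) ν ∧ ∫ y, y ^ p ∂ν < 1 := by
  have hsub : Integrable (fun y => y ^ κ - 1) ν := hint.sub (integrable_const _)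
  have haff : Integrable (fun y => 1 + p / κ * (y ^ κ - 1)) ν :=
    (integrable_const _).add (hsub.const_mul _)
  have hpi : Integrable (fun y => y ^ p) ν := by
    refine haff.mono' (by fun_prop) ?_
    filter_upwards [hν] with y hy
    rw [Real.norm_of_nonneg (by positivity)]
    exact rpow_le_affine hp hpκ hy
  refine ⟨hpi, ?_⟩
  have h1 : ∫ y, (1 + p / κ * (y ^ κ - 1)) ∂ν = 1 := by
    rw [integral_add (integrable_const _) (hsub.const_mul _),
      integral_const_mul, integral_sub hint (integrable_const _), hone]
    simp
  rw [← sub_pos, ← h1, ← integral_sub haff hpi]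
  refine (integral_pos_iff_support_of_nonneg_ae ?_ (haff.sub hpi)).2 ?_
  · filter_upwards [hν] with y hy
    exact sub_nonneg.2 (rpow_le_affine hp hpκ hy)
  · refine (pos_iff_ne_zero.2 hne).trans_le (measure_mono_ae ?_)
    filter_upwards [hν] with y hy hlog
    exact (sub_pos.2 (rpow_lt_affine hp hpκ hy hlog)).ne'

lemma integral_rpow_mul_log_pos (hκ : 0 < κ) (hν : ∀ᵐ y ∂ν, 0 < y)
    (hint : Integrable (fun y => y ^ κ) ν) (hone : ∫ y, y ^ κ ∂ν = 1)
    (hlog : Integrable (fun y => y ^ κ * Real.log y) ν)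
    (hne : ν {y | Real.log y ≠ 0} ≠ 0) : 0 < ∫ y, y ^ κ * Real.log y ∂ν := by
  have hsub : Integrable (fun y => y ^ κ - 1) ν := hint.sub (integrable_const _)
  have h1 : ∫ y, (κ * (y ^ κ * Real.log y) - (y ^ κ - 1)) ∂ν =
      κ * ∫ y, y ^ κ * Real.log y ∂ν := by
    rw [integral_sub (hlog.const_mul κ) hsub, integral_const_mul,
      integral_sub hint (integrable_const _), hone]
    simp
  refine pos_of_mul_pos_right (a := κ) ?_ hκ.le
  rw [← h1]
  refine (integral_pos_iff_support_of_nonneg_ae ?_ ((hlog.const_mul κ).sub hsub)).2 ?_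
  · filter_upwards [hν] with y hy
    exact sub_nonneg.2 (rpow_mul_log_le hy)
  · refine (pos_iff_ne_zero.2 hne).trans_le (measure_mono_ae ?_)
    filter_upwards [hν] with y hy hlog
    exact (sub_pos.2 (rpow_mul_log_lt hκ hy hlog)).ne'

lemma integrable_rpow_mul_log (hκ : 0 < κ) {b : ℝ} (hb : 0 < b) (hν : ∀ᵐ y ∂ν, b ≤ y)
    (hpos : Integrable (fun y => y ^ κ * max (Real.log y) 0) ν) :
    Integrable (fun y => y ^ κ * Real.log y) ν := by
  refine (hpos.add (integrable_const |Real.log b|)).mono' (by fun_prop) ?_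
  filter_upwards [hν] with y hy
  have hy0 := hb.trans_le hy
  have hw := Real.rpow_pos_of_pos hy0 κ
  rw [norm_mul, Real.norm_of_nonneg hw.le, Real.norm_eq_abs]
  simp only [Pi.add_apply]
  rcases le_total 0 (Real.log y) with h | h
  · rw [abs_of_nonneg h, max_eq_left h]
    linarith [abs_nonneg (Real.log b)]
  · rw [max_eq_right h, mul_zero, zero_add, abs_of_nonpos h]
    have h1 : y ^ κ ≤ 1 :=
      Real.rpow_le_one hy0.le ((Real.log_nonpos_iff hy0.le).1 h) hκ.le
    have h2 := Real.log_le_log hb hy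
    nlinarith [neg_abs_le (Real.log b)]

end Logistic

section TiltedLogLaw

variable {ν : Measure ℝ} {κ : ℝ}

/-- The law of `log ξ` under the exponentially tilted measure `ξ ^ κ dP`, for `ξ ∼ ν`. -/
def tiltedLogLaw (ν : Measure ℝ) (κ : ℝ) : Measure ℝ :=
  (ν.withDensity fun y => ENNReal.ofReal (y ^ κ)).map Real.log

lemma integral_tiltedLogLaw (hν : ∀ᵐ y ∂ν, 0 < y) {f : ℝ → ℝ} (hf : Measurable f) :
    ∫ z, f z ∂(tiltedLogLaw ν κ) = ∫ y, y ^ κ * f (Real.log y) ∂ν := by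
  rw [tiltedLogLaw, integral_map (by fun_prop) hf.aestronglyMeasurable,
    integral_withDensity_eq_integral_toReal_smul (by fun_prop)
      (.of_forall fun _ => ENNReal.ofReal_lt_top)]
  refine integral_congr_ae ?_
  filter_upwards [hν] with y hy
  rw [ENNReal.toReal_ofReal (Real.rpow_nonneg hy.le _), smul_eq_mul]

lemma isProbabilityMeasure_tiltedLogLaw (hν : ∀ᵐ y ∂ν, 0 < y)
    (hint : Integrable (fun y => y ^ κ) ν) (hone : ∫ y, y ^ κ ∂ν = 1) :
    IsProbabilityMeasure (tiltedLogLaw ν κ) := by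
  have : IsProbabilityMeasure (ν.withDensity fun y => ENNReal.ofReal (y ^ κ)) := ⟨by
    rw [withDensity_apply _ MeasurableSet.univ, setLIntegral_univ,
      ← ofReal_integral_eq_lintegral_ofReal hint, hone, ENNReal.ofReal_one]
    filter_upwards [hν] with y hy
    exact Real.rpow_nonneg hy.le _⟩
  exact Measure.isProbabilityMeasure_map (by fun_prop)

lemma ae_tiltedLogLaw_le {b : ℝ} (hb : 0 < b) (hν : ∀ᵐ y ∂ν, b ≤ y) :
    ∀ᵐ z ∂(tiltedLogLaw ν κ), -(-Real.log b) ≤ z := by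
  rw [neg_neg, tiltedLogLaw, ae_map_iff (by fun_prop) measurableSet_Ici]
  refine (withDensity_absolutelyContinuous _ _).ae_le ?_
  filter_upwards [hν] with y hy
  exact Real.log_le_log hb hy

lemma integrable_id_tiltedLogLaw (hν : ∀ᵐ y ∂ν, 0 < y)
    (hlog : Integrable (fun y => y ^ κ * Real.log y) ν) :
    Integrable (fun z => z) (tiltedLogLaw ν κ) := by
  rw [tiltedLogLaw, integrable_map_measure (by fun_prop) (by fun_prop),
    integrable_withDensity_iff_integrable_smul' (by fun_prop)
      (.of_forall fun _ => ENNReal.ofReal_lt_top)]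
  refine hlog.congr ?_
  filter_upwards [hν] with y hy
  rw [ENNReal.toReal_ofReal (Real.rpow_nonneg hy.le _), smul_eq_mul]
  rfl

lemma tiltedLogLaw_pos (hν : ∀ᵐ y ∂ν, 0 < y) {s : Set ℝ} (hs : 0 < ν (Real.log ⁻¹' s)) :
    0 < tiltedLogLaw ν κ s := by
  refine (pos_iff_ne_zero.2 fun h => hs.ne' ?_).trans_le
    (Measure.le_map_apply (by fun_prop) s)
  refine withDensity_absolutelyContinuous' (by fun_prop) ?_ h
  filter_upwards [hν] with y hy
  exact (ENNReal.ofReal_pos.2 (Real.rpow_pos_of_pos hy _)).ne'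

end TiltedLogLaw

section Stationary

variable {ν π : Measure ℝ} {κ : ℝ}

lemma ae_prod_of_ae [SFinite ν] [SFinite π] {P Q : ℝ → Prop} (hP : ∀ᵐ x ∂π, P x)
    (hQ : ∀ᵐ y ∂ν, Q y) :
    ∀ᵐ q : ℝ × ℝ ∂(π.prod ν), P q.1 ∧ Q q.2 :=
  (Measure.quasiMeasurePreserving_fst.ae hP).and (Measure.quasiMeasurePreserving_snd.ae hQ)

lemma integral_eq_of_stationary [SFinite ν]
    (hstat : Measure.map (fun q : ℝ × ℝ => q.1 * (1 - q.1) / q.2) (π.prod ν) = π)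
    {f : ℝ → ℝ} (hf : Measurable f) :
    ∫ x, f x ∂π = ∫ q : ℝ × ℝ, f (q.1 * (1 - q.1) / q.2) ∂(π.prod ν) := by
  conv_lhs => rw [← hstat]
  exact integral_map (by fun_prop) hf.aestronglyMeasurable

variable [IsProbabilityMeasure ν] [IsProbabilityMeasure π]

lemma ae_mem_Ioc_of_stationary {a : ℝ} (ha : 0 < a) (hν : ∀ᵐ y ∂ν, a ≤ 4 * y)
    (hX : ∀ᵐ x ∂π, x ∈ Ioo (0 : ℝ) 1)
    (hstat : Measure.map (fun q : ℝ × ℝ => q.1 * (1 - q.1) / q.2) (π.prod ν) = π) :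
    ∀ᵐ x ∂π, x ∈ Ioc 0 a⁻¹ := by
  rw [← hstat]
  refine (ae_map_iff (p := fun x => x ∈ Ioc 0 a⁻¹) (by fun_prop) measurableSet_Ioc).2 ?_
  filter_upwards [ae_prod_of_ae hX hν] with q ⟨⟨h0, h1⟩, h2⟩
  have hq : 0 < q.2 := by linarith
  refine ⟨div_pos (mul_pos h0 (by linarith)) hq, ?_⟩
  rw [div_le_iff₀ hq, inv_mul_eq_div, le_div_iff₀ ha]
  nlinarith [sq_nonneg (2 * q.1 - 1), mul_pos h0 (sub_pos.2 h1)]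

lemma logistic_rpow_neg {p x y : ℝ} (hx : 0 ≤ x) (hx1 : x ≤ 1) (hy : 0 ≤ y) :
    (x * (1 - x) / y) ^ (-p) = y ^ p * (x ^ (-p) * (1 - x) ^ (-p)) := by
  have h1 : 0 ≤ 1 - x := by linarith
  rw [Real.div_rpow (by positivity) hy, Real.mul_rpow hx h1, Real.rpow_neg hy p, div_inv_eq_mul,
    mul_comm]

lemma div_rpow_neg {p x y : ℝ} (hx : 0 ≤ x) (hy : 0 ≤ y) :
    (x / y) ^ (-p) = y ^ p * x ^ (-p) := by
  rw [Real.div_rpow hx hy, Real.rpow_neg hy p, div_inv_eq_mul, mul_comm]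

/-- Drift condition for the Lyapunov function `x ^ (-p)`. -/
lemma exists_logistic_drift {a p η : ℝ} (ha : 1 < a) (hp : 0 < p) (hη : 0 < η) :
    ∃ C, 0 ≤ C ∧ ∀ x, 0 < x → x ≤ a⁻¹ →
      x ^ (-p) * (1 - x) ^ (-p) ≤ (1 + η) * x ^ (-p) + C := by
  obtain ⟨c, hc, h⟩ := exists_one_sub_rpow_neg_le ha hp
  refine ⟨c * (η / c) ^ (-p), by positivity, fun x hx hxa => ?_⟩
  have hx1 : x ≤ 1 := hxa.trans (inv_le_one_of_one_le₀ ha.le)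
  have hw := Real.rpow_pos_of_pos hx (-p)
  have h1 : x ^ (-p) * (1 - x) ^ (-p) ≤ x ^ (-p) * (1 + c * x) := by
    gcongr; exact h x hx hxa
  refine h1.trans ?_
  rcases le_total x (η / c) with hxc | hxc
  · have h2 : c * x ≤ η := by rwa [le_div_iff₀ hc, mul_comm] at hxc
    have h3 : 0 ≤ c * (η / c) ^ (-p) := by positivity
    nlinarith
  · have h2 : x ^ (-p) ≤ (η / c) ^ (-p) :=
      Real.rpow_le_rpow_of_nonpos (by positivity) hxc (by linarith)
    have h3 : x ^ (-p) * (c * x) ≤ (η / c) ^ (-p) * (c * 1) := by gcongr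
    nlinarith

/-- A stationary law integrates a nonnegative Lyapunov function satisfying a contractive
drift condition, expressed through truncated expectations. -/
lemma integrable_of_truncated_contraction {f : ℝ → ℝ} (hf : Measurable f)
    (hf0 : ∀ᵐ x ∂π, 0 ≤ f x) {ρ C : ℝ} (hρ0 : 0 ≤ ρ) (hρ : ρ < 1) (hC : 0 ≤ C)
    (hstep : ∀ α β N : ℝ, 0 ≤ α → 0 ≤ β → 0 ≤ N →
      ∫ x, min (α * f x + β) N ∂π ≤ ∫ x, min (α * (ρ * f x + C) + β) N ∂π) :
    Integrable f π := by
  set K := C / (1 - ρ) with hK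
  have h1ρ : 0 < 1 - ρ := by linarith
  have hKC : K * (1 - ρ) = C := div_mul_cancel₀ _ h1ρ.ne'
  have hK0 : 0 ≤ K := by positivity
  have hρn : ∀ n : ℕ, ρ ^ n ≤ 1 := fun n => pow_le_one₀ hρ0 hρ.le
  have hiter : ∀ N : ℝ, 0 ≤ N → ∀ n : ℕ,
      ∫ x, min (f x) N ∂π ≤ ∫ x, min (ρ ^ n * f x + K * (1 - ρ ^ n)) N ∂π := by
    intro N hN n
    induction n with
    | zero => simp
    | succ n ih =>
      refine (ih.trans (hstep _ _ N (by positivity)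
        (mul_nonneg hK0 (sub_nonneg.2 (hρn n))) hN)).trans (le_of_eq ?_)
      congr 1; ext x; congr 1
      rw [← hKC]; ring
  have hbound : ∀ N : ℝ, 0 ≤ N → ∫ x, min (f x) N ∂π ≤ K := by
    intro N hN
    have hlim : Tendsto (fun n : ℕ => ∫ x, min (ρ ^ n * f x + K * (1 - ρ ^ n)) N ∂π) atTop
        (𝓝 (∫ _, min K N ∂π)) := by
      refine tendsto_integral_of_dominated_convergence (fun _ => N) (fun n => by fun_prop)
        (integrable_const _) (fun n => ?_) (.of_forall fun x => ?_)
      · filter_upwards [hf0] with x hx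
        rw [Real.norm_of_nonneg]
        · exact min_le_right _ _
        · exact le_min (add_nonneg (mul_nonneg (by positivity) hx)
            (mul_nonneg hK0 (sub_nonneg.2 (hρn n)))) hN
      · have h := tendsto_pow_atTop_nhds_zero_of_lt_one hρ0 hρ
        have := ((h.mul_const (f x)).add ((h.const_sub 1).const_mul K)).min
          (tendsto_const_nhds (x := N))
        simpa using this
    refine (ge_of_tendsto' hlim (hiter N hN)).trans ?_
    simp
  have hcover : AECover π atTop (fun n : ℕ => {x | f x ≤ n}) :=
    { ae_eventually_mem := .of_forall fun x => by
        filter_upwards [eventually_ge_atTop ⌈f x⌉₊] with n hn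
        exact (Nat.le_ceil _).trans (Nat.cast_le.2 hn)
      measurableSet := fun n => measurableSet_le hf measurable_const }
  have hmin : ∀ n : ℕ, Integrable (fun x => min (f x) n) π := fun n => by
    refine Integrable.of_bound (by fun_prop) n ?_
    filter_upwards [hf0] with x hx
    rw [Real.norm_of_nonneg (le_min hx n.cast_nonneg)]
    exact min_le_right _ _
  have heq : ∀ n : ℕ, EqOn (fun x => min (f x) n) f {x | f x ≤ n} := fun n x hx =>
    min_eq_left hx
  refine hcover.integrable_of_integral_bounded_of_nonneg_ae K (fun n => ?_) hf0
    (.of_forall fun n => ?_)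
  · exact (integrableOn_congr_fun (heq n) (hcover.measurableSet n)).1 (hmin n).integrableOn
  · rw [← setIntegral_congr_fun (hcover.measurableSet n) (heq n)]
    refine (setIntegral_le_integral (hmin n) ?_).trans (hbound n n.cast_nonneg)
    filter_upwards [hf0] with x hx
    exact le_min hx n.cast_nonneg

/-- Stationary laws have all negative moments of order below the critical exponent. -/
lemma integrable_rpow_neg_of_stationary {a p : ℝ} (ha : 1 < a) (hp : 0 < p)
    (hν : ∀ᵐ y ∂ν, 0 < y) (hX : ∀ᵐ x ∂π, x ∈ Ioc 0 a⁻¹)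
    (hstat : Measure.map (fun q : ℝ × ℝ => q.1 * (1 - q.1) / q.2) (π.prod ν) = π)
    (hint : Integrable (fun y => y ^ p) ν) (hlt : ∫ y, y ^ p ∂ν < 1) :
    Integrable (fun x => x ^ (-p)) π := by
  set θ := ∫ y, y ^ p ∂ν with hθ
  have hθ0 : 0 ≤ θ := integral_nonneg_of_ae (by
    filter_upwards [hν] with y hy
    exact Real.rpow_nonneg hy.le _)
  obtain ⟨C, hC, hdrift⟩ := exists_logistic_drift (η := (1 - θ)) ha hp (by linarith)
  have hX0 : ∀ᵐ x ∂π, 0 ≤ x ^ (-p) := by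
    filter_upwards [hX] with x hx
    exact Real.rpow_nonneg hx.1.le _
  refine integrable_of_truncated_contraction (by fun_prop) hX0 (ρ := θ * (1 + (1 - θ)))
    (C := θ * C) (mul_nonneg hθ0 (by linarith)) (by nlinarith [sq_pos_of_pos (sub_pos.2 hlt)])
    (mul_nonneg hθ0 hC) fun α β N hα hβ hN => ?_
  rw [integral_eq_of_stationary hstat (f := fun x => min (α * x ^ (-p) + β) N) (by fun_prop)]
  have hi : Integrable (fun q : ℝ × ℝ =>
      min (α * (q.1 * (1 - q.1) / q.2) ^ (-p) + β) N) (π.prod ν) := by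
    refine Integrable.of_bound (Measurable.aestronglyMeasurable (by fun_prop)) N ?_
    filter_upwards [ae_prod_of_ae hX hν] with q ⟨⟨h0, h1⟩, h2⟩
    have hq1 : q.1 ≤ 1 := h1.trans (inv_le_one_of_one_le₀ ha.le)
    have : 0 ≤ 1 - q.1 := by linarith
    rw [Real.norm_of_nonneg (by positivity)]
    exact min_le_right _ _
  rw [integral_prod _ hi]
  refine integral_mono_ae hi.integral_prod_left ?_ ?_
  · refine Integrable.of_bound (by fun_prop) N ?_
    filter_upwards [hX0] with x hx
    have : 0 ≤ α * (θ * (1 + (1 - θ)) * x ^ (-p) + θ * C) + β := by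
      have : 0 ≤ 1 + (1 - θ) := by linarith
      positivity
    rw [Real.norm_of_nonneg (le_min this hN)]
    exact min_le_right _ _
  · filter_upwards [hX, hi.prod_right_ae] with x hx hxi
    have hx1 : x ≤ 1 := hx.2.trans (inv_le_one_of_one_le₀ ha.le)
    refine le_min ?_ ?_
    · have hiy : Integrable (fun y =>
          α * (y ^ p * ((1 + (1 - θ)) * x ^ (-p) + C)) + β) ν :=
        ((hint.mul_const _).const_mul _).add (integrable_const _)
      refine (integral_mono_ae hxi hiy ?_).trans (le_of_eq ?_)
      · filter_upwards [hν] with y hy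
        refine (min_le_left _ _).trans ?_
        rw [logistic_rpow_neg hx.1.le hx1 hy.le]
        gcongr
        exact hdrift x hx.1 hx.2
      · rw [integral_add ((hint.mul_const _).const_mul _) (integrable_const _),
          integral_const_mul, integral_mul_const]
        simp only [integral_const, probReal_univ, one_smul]
        ring
    · refine (integral_mono_ae hxi (integrable_const N)
        (.of_forall fun y => min_le_right _ _)).trans
        (le_of_eq (by simp))

/-- The defect in the renewal equation for the truncated moment. -/
def logisticDefect (ν π : Measure ℝ) (κ t : ℝ) : ℝ :=
  ∫ q : ℝ × ℝ, (min (Real.exp (κ * t)) ((q.1 * (1 - q.1) / q.2) ^ (-κ)) -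
    min (Real.exp (κ * t)) ((q.1 / q.2) ^ (-κ))) ∂(π.prod ν)

lemma truncMoment_logistic_eq {a : ℝ} (ha : 1 < a) (hν : ∀ᵐ y ∂ν, 0 < y)
    (hX : ∀ᵐ x ∂π, x ∈ Ioc 0 a⁻¹)
    (hstat : Measure.map (fun q : ℝ × ℝ => q.1 * (1 - q.1) / q.2) (π.prod ν) = π)
    (hκ : 0 < κ) (t : ℝ) :
    truncMoment π κ t =
      (∫ z, truncMoment π κ (t - z) ∂(tiltedLogLaw ν κ)) + logisticDefect ν π κ t := by
  have hX0 : ∀ᵐ x ∂π, 0 < x := hX.mono fun x hx => hx.1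
  have hi₁ : Integrable (fun q : ℝ × ℝ =>
      min (Real.exp (κ * t)) ((q.1 * (1 - q.1) / q.2) ^ (-κ))) (π.prod ν) := by
    refine Integrable.of_bound (Measurable.aestronglyMeasurable (by fun_prop))
      (Real.exp (κ * t)) ?_
    filter_upwards [ae_prod_of_ae hX hν] with q ⟨⟨h0, h1⟩, h2⟩
    have : 0 ≤ 1 - q.1 := by linarith [inv_le_one_of_one_le₀ ha.le]
    rw [Real.norm_of_nonneg (by positivity)]
    exact min_le_left _ _
  have hi₂ : Integrable (fun q : ℝ × ℝ =>
      min (Real.exp (κ * t)) ((q.1 / q.2) ^ (-κ))) (π.prod ν) := by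
    refine Integrable.of_bound (Measurable.aestronglyMeasurable (by fun_prop))
      (Real.exp (κ * t)) ?_
    filter_upwards [ae_prod_of_ae hX hν] with q ⟨⟨h0, h1⟩, h2⟩
    rw [Real.norm_of_nonneg (by positivity)]
    exact min_le_left _ _
  have h1 : truncMoment π κ t = ∫ q : ℝ × ℝ,
      min (Real.exp (κ * t)) ((q.1 * (1 - q.1) / q.2) ^ (-κ)) ∂(π.prod ν) :=
    integral_eq_of_stationary hstat (f := fun x => min (Real.exp (κ * t)) (x ^ (-κ)))
      (by fun_prop)
  have h2 : ∫ z, truncMoment π κ (t - z) ∂(tiltedLogLaw ν κ) =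
      ∫ q : ℝ × ℝ, min (Real.exp (κ * t)) ((q.1 / q.2) ^ (-κ)) ∂(π.prod ν) := by
    rw [integral_tiltedLogLaw hν (f := fun z => truncMoment π κ (t - z))
      ((truncMoment_mono hκ hX0).measurable.comp (measurable_const.sub measurable_id)),
      integral_prod_symm _ hi₂]
    refine integral_congr_ae ?_
    filter_upwards [hν] with y hy
    rw [truncMoment, ← integral_const_mul]
    refine integral_congr_ae ?_
    filter_upwards [hX0] with x hx
    have hw := Real.rpow_pos_of_pos hy κ
    rw [mul_min_of_nonneg _ _ hw.le, div_rpow_neg hx.le hy.le]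
    congr 1
    rw [Real.rpow_def_of_pos hy, ← Real.exp_add]
    ring_nf
  rw [h1, h2, logisticDefect, integral_sub hi₁ hi₂]
  ring

lemma logistic_rpow_gap {p x y : ℝ} (hp : 0 < p) (hx : 0 < x) (hx1 : x < 1) (hy : 0 < y) :
    (x / y) ^ (-p) < (x * (1 - x) / y) ^ (-p) := by
  have h1 : 0 < 1 - x := by linarith
  refine Real.rpow_lt_rpow_of_neg (by positivity) ?_ (by linarith)
  gcongr
  nlinarith

/-- The difference of negative powers in the tail constant is integrable. -/
lemma integrable_logistic_gap {a : ℝ} (ha : 1 < a) (hκ : 0 < κ) (hν : ∀ᵐ y ∂ν, 0 < y)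
    (hX : ∀ᵐ x ∂π, x ∈ Ioc 0 a⁻¹) (hint : Integrable (fun y => y ^ κ) ν)
    (hmom : ∀ p, 0 < p → p < κ → Integrable (fun x => x ^ (-p)) π) :
    Integrable (fun q : ℝ × ℝ => (q.1 * (1 - q.1) / q.2) ^ (-κ) - (q.1 / q.2) ^ (-κ))
      (π.prod ν) := by
  obtain ⟨c, hc, h⟩ := exists_one_sub_rpow_neg_le ha hκ
  have hp0 : 0 < max (κ - 1) (κ / 2) := lt_max_of_lt_right (by linarith)
  have hpκ : max (κ - 1) (κ / 2) < κ := max_lt (by linarith) (by linarith)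
  refine (((hmom _ hp0 hpκ).mul_prod hint).const_mul c).mono'
    (Measurable.aestronglyMeasurable (by fun_prop)) ?_
  filter_upwards [ae_prod_of_ae hX hν] with q ⟨⟨h0, h1⟩, h2⟩
  have hq1 : q.1 < 1 := h1.trans_lt (inv_lt_one_of_one_lt₀ ha)
  rw [Real.norm_of_nonneg (sub_nonneg.2 (logistic_rpow_gap hκ h0 hq1 h2).le),
    logistic_rpow_neg h0.le hq1.le h2.le, div_rpow_neg h0.le h2.le]
  have hw := Real.rpow_pos_of_pos h2 κ
  have hv := Real.rpow_pos_of_pos h0 (-κ)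
  have h3 : q.1 ^ (-κ) * q.1 ≤ q.1 ^ (-max (κ - 1) (κ / 2)) := by
    nth_rewrite 2 [← Real.rpow_one q.1]
    rw [← Real.rpow_add h0]
    exact Real.rpow_le_rpow_of_exponent_ge h0 hq1.le
      (by linarith [le_max_left (κ - 1) (κ / 2)])
  calc _ = q.2 ^ κ * q.1 ^ (-κ) * ((1 - q.1) ^ (-κ) - 1) := by ring
    _ ≤ q.2 ^ κ * q.1 ^ (-κ) * (c * q.1) := by
      gcongr; linarith [h q.1 h0 h1]
    _ = c * (q.1 ^ (-κ) * q.1 * q.2 ^ κ) := by ring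
    _ ≤ _ := by gcongr

lemma integral_logistic_gap_pos {a : ℝ} (ha : 1 < a) (hκ : 0 < κ) (hν : ∀ᵐ y ∂ν, 0 < y)
    (hX : ∀ᵐ x ∂π, x ∈ Ioc 0 a⁻¹)
    (hi : Integrable (fun q : ℝ × ℝ => (q.1 * (1 - q.1) / q.2) ^ (-κ) - (q.1 / q.2) ^ (-κ))
      (π.prod ν)) :
    0 < ∫ q : ℝ × ℝ, ((q.1 * (1 - q.1) / q.2) ^ (-κ) - (q.1 / q.2) ^ (-κ)) ∂(π.prod ν) := by
  have hpos : ∀ᵐ q : ℝ × ℝ ∂(π.prod ν),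
      0 < (q.1 * (1 - q.1) / q.2) ^ (-κ) - (q.1 / q.2) ^ (-κ) := by
    filter_upwards [ae_prod_of_ae hX hν] with q ⟨⟨h0, h1⟩, h2⟩
    exact sub_pos.2 (logistic_rpow_gap hκ h0 (h1.trans_lt (inv_lt_one_of_one_lt₀ ha)) h2)
  refine (integral_pos_iff_support_of_nonneg_ae (hpos.mono fun q hq => hq.le) hi).2 ?_
  refine pos_iff_ne_zero.2 fun h => ?_
  obtain ⟨q, hq₁, hq₂⟩ := (hpos.and (measure_eq_zero_iff_ae_notMem.1 h)).exists
  exact absurd hq₁.ne' hq₂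

/-- The defect is dominated by, and converges to, the integrated gap. -/
lemma logisticDefect_bound_and_tendsto {a : ℝ} (ha : 1 < a) (hκ : 0 < κ)
    (hν : ∀ᵐ y ∂ν, 0 < y) (hX : ∀ᵐ x ∂π, x ∈ Ioc 0 a⁻¹)
    (hi : Integrable (fun q : ℝ × ℝ => (q.1 * (1 - q.1) / q.2) ^ (-κ) - (q.1 / q.2) ^ (-κ))
      (π.prod ν)) :
    (∀ t, |logisticDefect ν π κ t| ≤
      ∫ q : ℝ × ℝ, ((q.1 * (1 - q.1) / q.2) ^ (-κ) - (q.1 / q.2) ^ (-κ)) ∂(π.prod ν)) ∧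
    Tendsto (logisticDefect ν π κ) atTop (𝓝 (∫ q : ℝ × ℝ,
      ((q.1 * (1 - q.1) / q.2) ^ (-κ) - (q.1 / q.2) ^ (-κ)) ∂(π.prod ν))) := by
  have hdom : ∀ t, ∀ᵐ q : ℝ × ℝ ∂(π.prod ν),
      ‖min (Real.exp (κ * t)) ((q.1 * (1 - q.1) / q.2) ^ (-κ)) -
        min (Real.exp (κ * t)) ((q.1 / q.2) ^ (-κ))‖ ≤
      (q.1 * (1 - q.1) / q.2) ^ (-κ) - (q.1 / q.2) ^ (-κ) := fun t => by
    filter_upwards [ae_prod_of_ae hX hν] with q ⟨⟨h0, h1⟩, h2⟩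
    have hgap := logistic_rpow_gap hκ h0 (h1.trans_lt (inv_lt_one_of_one_lt₀ ha)) h2
    refine (abs_min_sub_min_le_max _ _ _ _).trans (max_le ?_ ?_)
    · simpa using hgap.le
    · rw [abs_of_pos (sub_pos.2 hgap)]
  refine ⟨fun t => norm_integral_le_of_norm_le hi (hdom t), ?_⟩
  refine tendsto_integral_filter_of_dominated_convergence _
    (.of_forall fun t => Measurable.aestronglyMeasurable (by fun_prop)) (.of_forall hdom) hi
    (.of_forall fun q => ?_)
  have htop : Tendsto (fun t => Real.exp (κ * t)) atTop atTop :=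
    Real.tendsto_exp_atTop.comp (tendsto_id.const_mul_atTop hκ)
  refine tendsto_const_nhds.congr' ?_
  filter_upwards [htop.eventually_ge_atTop ((q.1 * (1 - q.1) / q.2) ^ (-κ)),
    htop.eventually_ge_atTop ((q.1 / q.2) ^ (-κ))] with t ht₁ ht₂
  rw [min_eq_right ht₁, min_eq_right ht₂]

end Stationary

section ExactTail

variable {π : Measure ℝ} {κ c : ℝ}

lemma tendsto_rpow_mul_measure_Ioo (h : Tendsto (scaledTail π κ) atTop (𝓝 c)) :
    Tendsto (fun x : ℝ => x ^ (-κ) * (π (Ioo 0 x)).toReal) (𝓝[>] 0) (𝓝 c) := by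
  refine (h.comp (tendsto_neg_atBot_atTop.comp Real.tendsto_log_nhdsGT_zero)).congr' ?_
  filter_upwards [self_mem_nhdsWithin] with x hx
  have hx : 0 < x := hx
  simp only [Function.comp_apply, scaledTail, neg_neg, Real.exp_log hx, measureReal_def]
  rw [Real.rpow_def_of_pos hx]
  ring_nf

lemma exact_tail_of_tendsto [IsProbabilityMeasure π] (hc : 0 < c)
    (h : Tendsto (fun x : ℝ => x ^ (-κ) * (π (Ioo 0 x)).toReal) (𝓝[>] 0) (𝓝 c)) :
    0 < liminf (fun t : ℝ => ENNReal.ofReal (t ^ κ) * π (Ioo 0 t⁻¹)) atTop ∧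
      limsup (fun t : ℝ => ENNReal.ofReal (t ^ κ) * π (Ioo 0 t⁻¹)) atTop < ⊤ := by
  have hlim : Tendsto (fun t : ℝ => ENNReal.ofReal (t ^ κ) * π (Ioo 0 t⁻¹)) atTop
      (𝓝 (ENNReal.ofReal c)) := by
    refine (ENNReal.tendsto_ofReal (h.comp tendsto_inv_atTop_nhdsGT_zero)).congr' ?_
    filter_upwards [eventually_gt_atTop 0] with t ht
    rw [Function.comp_apply, Real.inv_rpow ht.le, Real.rpow_neg ht.le, inv_inv,
      ENNReal.ofReal_mul (by positivity), ENNReal.ofReal_toReal (measure_ne_top _ _)]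
  rw [hlim.liminf_eq, hlim.limsup_eq]
  exact ⟨ENNReal.ofReal_pos.2 hc, ENNReal.ofReal_lt_top⟩

end ExactTail

/-- **Random logistic transforms, bounded-noise case.**  If in addition `4ξ ≥ a` a.s.
for some `a ∈ (1,4)`, then any stationary distribution `π` on `(0,1)` of
`Xₙ = ξₙ^{−1}X_{n−1}(1−X_{n−1})` satisfies `π((0,1/a]) = 1` and
`lim_{x↓0} x^{−κ}π((0,x)) = E(Φ(X)^{−κ} − (X/ξ)^{−κ})/(κμ_κ) ∈ (0,∞)`,
with `X ∼ π` independent of `ξ`, `Φ(x) = ξ^{-1}x(1-x)` and `μ_κ = Eξ^κ log ξ`;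
in particular `π̂`, given by `π̂((x,∞)) = π((0,1/x))`, has exact tail index `κ`. -/
theorem logistic_bounded_noise_exact_tail
    (ν : Measure ℝ) [IsProbabilityMeasure ν]
    (hsupp : ∀ᵐ x ∂ν, (1 : ℝ) / 4 ≤ x)
    (hlogInt : Integrable Real.log ν)
    (hlogNeg : (∫ x, Real.log x ∂ν) < 0)
    (hlog4 : Integrable (fun x => |Real.log (4 * x - 1)|) ν)
    (κ : ℝ) (hIRT : SatisfiesIRT ν id κ)
    (a : ℝ) (ha1 : 1 < a) (ha4 : a < 4)
    (hbound : ∀ᵐ x ∂ν, a ≤ 4 * x)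
    (π : Measure ℝ) [IsProbabilityMeasure π]
    (hπsupp : π (Ioo 0 1) = 1)
    (hπstat : Measure.map (fun q : ℝ × ℝ => q.1 * (1 - q.1) / q.2) (π.prod ν) = π) :
    π (Ioc 0 a⁻¹) = 1 ∧
    0 < (∫ q : ℝ × ℝ, ((q.1 * (1 - q.1) / q.2) ^ (-κ) - (q.1 / q.2) ^ (-κ))
          ∂(π.prod ν)) /
        (κ * ∫ x, x ^ κ * Real.log x ∂ν) ∧
    Tendsto (fun x : ℝ => x ^ (-κ) * (π (Ioo 0 x)).toReal) (𝓝[>] 0)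
      (nhds ((∫ q : ℝ × ℝ, ((q.1 * (1 - q.1) / q.2) ^ (-κ) - (q.1 / q.2) ^ (-κ))
          ∂(π.prod ν)) /
        (κ * ∫ x, x ^ κ * Real.log x ∂ν))) ∧
    (0 < liminf (fun t : ℝ => ENNReal.ofReal (t ^ κ) * π (Ioo 0 t⁻¹)) atTop ∧
      limsup (fun t : ℝ => ENNReal.ofReal (t ^ κ) * π (Ioo 0 t⁻¹)) atTop < ⊤) := by
  obtain ⟨hκ, hone', hpos', hna'⟩ := hIRT
  have hb : 0 < a / 4 := by linarith
  have hνb : ∀ᵐ y ∂ν, a / 4 ≤ y := hbound.mono fun y hy => by linarith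
  have hν : ∀ᵐ y ∂ν, 0 < y := hνb.mono fun y hy => hb.trans_le hy
  have hone : ∫ y, y ^ κ ∂ν = 1 := by
    rw [← hone']
    exact integral_congr_ae (hν.mono fun y hy => by simp [abs_of_pos hy])
  have hint : Integrable (fun y => y ^ κ) ν := by
    by_contra h
    exact zero_ne_one ((integral_undef h).symm.trans hone)
  have hlog : Integrable (fun y => y ^ κ * Real.log y) ν :=
    integrable_rpow_mul_log hκ hb hνb
      (hpos'.congr (hν.mono fun y hy => by simp [abs_of_pos hy]))
  have hne : ν {y | Real.log y ≠ 0} ≠ 0 :=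
    ((hna' 0).trans_le (measure_mono fun y hy => by simpa using hy.2)).ne'
  have hX01 : ∀ᵐ x ∂π, x ∈ Ioo (0 : ℝ) 1 := mem_ae_iff_prob_eq_one measurableSet_Ioo |>.2 hπsupp
  have hX := ae_mem_Ioc_of_stationary (by linarith) hbound hX01 hπstat
  have hmom : ∀ p, 0 < p → p < κ → Integrable (fun x => x ^ (-p)) π := fun p hp hpκ =>
    have h := integral_rpow_lt_one hp hpκ hν hint hone hne
    integrable_rpow_neg_of_stationary ha1 hp hν hX hπstat h.1 h.2
  have hm := integral_rpow_mul_log_pos hκ hν hint hone hlog hne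
  have hgap := integrable_logistic_gap ha1 hκ hν hX hint hmom
  have hD := integral_logistic_gap_pos ha1 hκ hν hX hgap
  obtain ⟨hGD, hG⟩ := logisticDefect_bound_and_tendsto ha1 hκ hν hX hgap
  have := isProbabilityMeasure_tiltedLogLaw hν hint hone
  have htail := tendsto_scaledTail hκ (hX.mono fun x hx => hx.1) hmom
    (ae_tiltedLogLaw_le hb hνb) (integrable_id_tiltedLogLaw hν hlog)
    (integral_tiltedLogLaw hν measurable_id) hm
    (fun c => tiltedLogLaw_pos hν ((hna' c).trans_le
      (measure_mono fun y hy k => by simpa using hy.2 k)))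
    (truncMoment_logistic_eq ha1 hν hX hπstat hκ) hGD hG
  have hc := div_pos hD (mul_pos hκ hm)
  have hlim := tendsto_rpow_mul_measure_Ioo htail
  obtain ⟨hinf, hsup⟩ := exact_tail_of_tendsto hc hlim
  exact ⟨(mem_ae_iff_prob_eq_one measurableSet_Ioc).1 hX, hc, hlim, hinf, hsup⟩
end
end

section
/- Let ξ, ξ₁ be iid random variables with values in [1/4,∞) and P(ξ ≥ 1/2) > 0, let π be a stationary distribution of the random logistic IFS Xₙ = ξₙ^{−1}X_{n−1}(1 − X_{n−1}) on (0,1), let π̂ be the law of W₀ := 1/X₀ with X₀ ∼ π independent of ξ₁, and set Ψ₁(w) = ξ₁(w + 1 + 1/(w − 1)) for w > 1. Define π̂* on (1,∞) by π̂*(A) := P(Ψ₁(W₀) ∈ A, ξ₁ ≥ 1/2)/P(ξ₁ ≥ 1/2). Then π̂*((t,∞)) ≥ π̂((2t,∞)) for all t > 1. -/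
open MeasureTheory ProbabilityTheory Filter Set

noncomputable section

/-- **Tail comparison for the geometrically sampled logistic chain.**  Let `π` be a
stationary distribution on `(0,1)` of `Xₙ = ξₙ^{−1}X_{n−1}(1−X_{n−1})` with
`ξ ∈ [1/4,∞)` and `P(ξ ≥ 1/2) > 0`; let `π̂` be the law of `W₀ = 1/X₀` and
`Ψ₁(w) = ξ₁(w + 1 + 1/(w−1))`.  Then the conditional law
`π̂*(A) = P(Ψ₁(W₀) ∈ A, ξ₁ ≥ 1/2)/P(ξ₁ ≥ 1/2)` satisfies
`π̂*((t,∞)) ≥ π̂((2t,∞))` for all `t > 1`. -/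
theorem logistic_sampled_tail_compare
    (ν : Measure ℝ) [IsProbabilityMeasure ν]
    (hsupp : ∀ᵐ x ∂ν, (1 : ℝ) / 4 ≤ x)
    (hhalf : 0 < ν (Ici (1 / 2 : ℝ)))
    (π : Measure ℝ) [IsProbabilityMeasure π]
    (hπsupp : π (Ioo 0 1) = 1)
    (hπstat : Measure.map (fun q : ℝ × ℝ => q.1 * (1 - q.1) / q.2) (π.prod ν) = π) :
    ∀ t : ℝ, 1 < t →
      π {y : ℝ | 2 * t < y⁻¹} ≤
        (π.prod ν) {q : ℝ × ℝ |
            t < q.2 * (q.1⁻¹ + 1 + (q.1⁻¹ - 1)⁻¹) ∧ 1 / 2 ≤ q.2} /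
          ν (Ici (1 / 2 : ℝ)) := by
  intro t ht
  rw [ENNReal.le_div_iff_mul_le (Or.inl hhalf.ne') (Or.inl (measure_ne_top ν _)),
    ← Measure.prod_prod]
  refine measure_mono ?_
  rintro ⟨y, x⟩ ⟨hy, hx⟩
  simp only [mem_ofPred_eq, mem_Ici] at hy hx ⊢
  have hinv : 0 < (y⁻¹ - 1)⁻¹ := inv_pos.2 (by linarith)
  exact ⟨by nlinarith, hx⟩
end
end
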